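/- arXiv:2201.02496 — 5 statements merged into one kernel-verified Lean document; each statement's English description precedes it below -/
import Mathlib

section
/- Let ⊢ ?Γ,Δ be a ?-prenex {⊗,⅋,&,⊕,1,⊥}-sequent. Then ⊢ ?Γ,Δ is provable in LLW if and only if ⊢ Δ is provable in InFLew[σ(Γ⊥)], where Γ⊥ applies the De Morgan negation to each member of Γ. -/
namespace Affine

/-- Intuitionistic formulas: the language 𝓛 (⊗, ⊸, &, ⊕, !, 1, ⊤, ⊥, 0)
together with the extra ILAL modality §. -/
inductive IForm : Type where
  | var (n : ℕ)
  | one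
  | top
  | bot
  | zero
  | tensor (A B : IForm)
  | limp (A B : IForm)
  | and (A B : IForm)
  | or (A B : IForm)
  | bang (A : IForm)
  | para (A : IForm)

namespace IForm

/-- membership in the language 𝓛 (no §) -/
def inL : IForm → Prop
  | para _ => False
  | tensor A B => inL A ∧ inL B
  | limp A B => inL A ∧ inL B
  | and A B => inL A ∧ inL B
  | or A B => inL A ∧ inL B
  | bang A => inL A
  | _ => True

/-- membership in the ⊥-free language 𝓛⁺ -/
def inLp : IForm → Prop
  | para _ => False
  | bot => False
  | tensor A B => inLp A ∧ inLp B
  | limp A B => inLp A ∧ inLp B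
  | and A B => inLp A ∧ inLp B
  | or A B => inLp A ∧ inLp B
  | bang A => inLp A
  | _ => True

/-- {⊗,⊸,&,⊕,1,⊥}-formulas -/
def inFLei : IForm → Prop
  | var _ => True
  | one => True
  | bot => True
  | tensor A B => inFLei A ∧ inFLei B
  | limp A B => inFLei A ∧ inFLei B
  | and A B => inFLei A ∧ inFLei B
  | or A B => inFLei A ∧ inFLei B
  | _ => False

/-- {⊗,⊸,&,⊕,1}-formulas -/
def inFLeiP : IForm → Prop
  | var _ => True
  | one => True
  | tensor A B => inFLeiP A ∧ inFLeiP B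
  | limp A B => inFLeiP A ∧ inFLeiP B
  | and A B => inFLeiP A ∧ inFLeiP B
  | or A B => inFLeiP A ∧ inFLeiP B
  | _ => False

/-- purely implicational ({⊸}-) formulas -/
def inImp : IForm → Prop
  | var _ => True
  | limp A B => inImp A ∧ inImp B
  | _ => False

/-- {⊸,!}-formulas -/
def inImpBang : IForm → Prop
  | var _ => True
  | limp A B => inImpBang A ∧ inImpBang B
  | bang A => inImpBang A
  | _ => False

/-- {⊸,!,§}-formulas: the language of ILAL -/
def inLAL : IForm → Prop
  | var _ => True
  | limp A B => inLAL A ∧ inLAL B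
  | bang A => inLAL A
  | para A => inLAL A
  | _ => False

end IForm

/-- A parametrized intuitionistic sequent calculus: `K` is the set of allowed
formulas (the fragment), `ax` the set of non-logical axioms, and the remaining
fields tell which optional rules are available. -/
structure ICalc where
  K : IForm → Prop
  ax : Set IForm
  wL : Prop      -- unrestricted left weakening (W)
  wR : Prop      -- right weakening (W')
  bD : Prop      -- dereliction (!D)
  bP : Prop      -- promotion (!P)
  bF : Prop      -- functorial promotion (!F)
  bW : Prop      -- !-weakening (!W), for linear systems
  lB : Prop      -- the ILAL rule (!)
  lP : Prop      -- the ILAL rule (§)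

/-- Provability of an intuitionistic sequent `Γ ⊢ X` (X a stoup) in the
parametrized calculus `C`. -/
inductive IPrv (C : ICalc) : Multiset IForm → Option IForm → Prop where
  | axiom' {B} : B ∈ C.ax → IPrv C 0 (some B)
  | init {A} : C.K A → IPrv C {A} (some A)
  | oneR : C.K .one → IPrv C 0 (some .one)
  | botL : C.K .bot → IPrv C {.bot} none
  | topR {Γ} : C.K .top → (∀ A ∈ Γ, C.K A) → IPrv C Γ (some .top)
  | zeroL {Γ X} : C.K .zero → (∀ A ∈ Γ, C.K A) → (∀ A, X = some A → C.K A) →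
      IPrv C (.zero ::ₘ Γ) X
  | cut {Γ Δ X A} : IPrv C Γ (some A) → IPrv C (A ::ₘ Δ) X → IPrv C (Γ + Δ) X
  | oneL {Γ X} : C.K .one → IPrv C Γ X → IPrv C (.one ::ₘ Γ) X
  | botR {Γ} : C.K .bot → IPrv C Γ none → IPrv C Γ (some .bot)
  | limpL {Γ Δ X A B} : C.K (.limp A B) → IPrv C Γ (some A) → IPrv C (B ::ₘ Δ) X →
      IPrv C (.limp A B ::ₘ (Γ + Δ)) X
  | limpR {Γ A B} : C.K (.limp A B) → IPrv C (A ::ₘ Γ) (some B) →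
      IPrv C Γ (some (.limp A B))
  | tensorL {Γ X A B} : C.K (.tensor A B) → IPrv C (A ::ₘ B ::ₘ Γ) X →
      IPrv C (.tensor A B ::ₘ Γ) X
  | tensorR {Γ Δ A B} : C.K (.tensor A B) → IPrv C Γ (some A) → IPrv C Δ (some B) →
      IPrv C (Γ + Δ) (some (.tensor A B))
  | withL1 {Γ X A B} : C.K (.and A B) → IPrv C (A ::ₘ Γ) X → IPrv C (.and A B ::ₘ Γ) X
  | withL2 {Γ X A B} : C.K (.and A B) → IPrv C (B ::ₘ Γ) X → IPrv C (.and A B ::ₘ Γ) X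
  | withR {Γ A B} : C.K (.and A B) → IPrv C Γ (some A) → IPrv C Γ (some B) →
      IPrv C Γ (some (.and A B))
  | plusL {Γ X A B} : C.K (.or A B) → IPrv C (A ::ₘ Γ) X → IPrv C (B ::ₘ Γ) X →
      IPrv C (.or A B ::ₘ Γ) X
  | plusR1 {Γ A B} : C.K (.or A B) → IPrv C Γ (some A) → IPrv C Γ (some (.or A B))
  | plusR2 {Γ A B} : C.K (.or A B) → IPrv C Γ (some B) → IPrv C Γ (some (.or A B))
  | bangD {Γ X A} : C.bD → C.K (.bang A) → IPrv C (A ::ₘ Γ) X → IPrv C (.bang A ::ₘ Γ) X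
  | bangP {Γ : Multiset IForm} {A} : C.bP → C.K (.bang A) → (∀ B ∈ Γ, C.K (.bang B)) →
      IPrv C (Γ.map .bang) (some A) → IPrv C (Γ.map .bang) (some (.bang A))
  | bangF {Γ : Multiset IForm} {A} : C.bF → C.K (.bang A) → (∀ B ∈ Γ, C.K (.bang B)) →
      IPrv C Γ (some A) → IPrv C (Γ.map .bang) (some (.bang A))
  | weakL {Γ X A} : C.wL → C.K A → IPrv C Γ X → IPrv C (A ::ₘ Γ) X
  | bangW {Γ X A} : C.bW → C.K (.bang A) → IPrv C Γ X → IPrv C (.bang A ::ₘ Γ) X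
  | bangC {Γ X A} : C.K (.bang A) → IPrv C (.bang A ::ₘ .bang A ::ₘ Γ) X →
      IPrv C (.bang A ::ₘ Γ) X
  | weakR {Γ A} : C.wR → C.K A → IPrv C Γ none → IPrv C Γ (some A)
  | lalBang {A} {E : Multiset IForm} : C.lB → C.K (.bang A) →
      (∀ B ∈ E, C.K (.bang B)) → Multiset.card E ≤ 1 → IPrv C E (some A) →
      IPrv C (E.map .bang) (some (.bang A))
  | lalPara {Γ Δ : Multiset IForm} {A} : C.lP → C.K (.para A) → (∀ B ∈ Γ, C.K (.bang B)) →
      (∀ B ∈ Δ, C.K (.para B)) → IPrv C (Γ + Δ) (some A) →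
      IPrv C (Γ.map .bang + Δ.map .para) (some (.para A))

/-- ILZW with a set of non-logical axioms. -/
def ILZWc (Φ : Set IForm) : ICalc :=
  ⟨IForm.inL, Φ, True, False, True, True, False, False, False, False⟩

/-- ILZW' = ILZW + right weakening, with a set of non-logical axioms. -/
def ILZWpc (Φ : Set IForm) : ICalc :=
  ⟨IForm.inL, Φ, True, True, True, True, False, False, False, False⟩

/-- ILLW: the ⊥-free fragment of ILZW. -/
def ILLWc (Φ : Set IForm) : ICalc :=
  ⟨IForm.inLp, Φ, True, False, True, True, False, False, False, False⟩

/-- IEZW: intuitionistic elementary affine logic with bottom. -/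
def IEZWc (Φ : Set IForm) : ICalc :=
  ⟨IForm.inL, Φ, True, False, False, False, True, False, False, False⟩

/-- IELW: the ⊥-free fragment of IEZW. -/
def IELWc (Φ : Set IForm) : ICalc :=
  ⟨IForm.inLp, Φ, True, False, False, False, True, False, False, False⟩

/-- FLei: the {⊗,⊸,&,⊕,1,⊥}-fragment of ILZW. -/
def FLeic (Φ : Set IForm) : ICalc :=
  ⟨IForm.inFLei, Φ, True, False, True, True, False, False, False, False⟩

/-- FLew: the {⊗,⊸,&,⊕,1,⊥}-fragment of ILZW'. -/
def FLewc (Φ : Set IForm) : ICalc :=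
  ⟨IForm.inFLei, Φ, True, True, True, True, False, False, False, False⟩

/-- FLei⁺: the {⊗,⊸,&,⊕,1}-fragment of ILZW. -/
def FLeiPc (Φ : Set IForm) : ICalc :=
  ⟨IForm.inFLeiP, Φ, True, False, True, True, False, False, False, False⟩

/-- BCK: the {⊸}-fragment of ILZW. -/
def BCKc (Φ : Set IForm) : ICalc :=
  ⟨IForm.inImp, Φ, True, False, True, True, False, False, False, False⟩

/-- The {⊸,!}-fragment of ILLW. -/
def ImpBangILLWc (Φ : Set IForm) : ICalc :=
  ⟨IForm.inImpBang, Φ, True, False, True, True, False, False, False, False⟩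

/-- ILL: intuitionistic linear logic (no unrestricted weakening, only !W). -/
def ILLc (Φ : Set IForm) : ICalc :=
  ⟨IForm.inLp, Φ, False, False, True, True, False, True, False, False⟩

/-- BCI: the {⊸}-fragment of ILL. -/
def BCIc (Φ : Set IForm) : ICalc :=
  ⟨IForm.inImp, Φ, False, False, True, True, False, True, False, False⟩

/-- ILAL: intuitionistic light affine logic. -/
def ILALc (Φ : Set IForm) : ICalc :=
  ⟨IForm.inLAL, Φ, True, False, False, False, False, False, True, True⟩

/-- Classical formulas: literals p, p⊥ and the connectives ⊗, ⅋, &, ⊕, 1, ⊥, ⊤, 0, !, ?. -/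
inductive CForm : Type where
  | pos (n : ℕ)
  | neg (n : ℕ)
  | one
  | bot
  | top
  | zero
  | tensor (A B : CForm)
  | par (A B : CForm)
  | and (A B : CForm)
  | or (A B : CForm)
  | bang (A : CForm)
  | quest (A : CForm)

namespace CForm

/-- De Morgan (involutive) negation. -/
def dual : CForm → CForm
  | pos n => neg n
  | neg n => pos n
  | one => bot
  | bot => one
  | top => zero
  | zero => top
  | tensor A B => par A.dual B.dual
  | par A B => tensor A.dual B.dual
  | and A B => or A.dual B.dual
  | or A B => and A.dual B.dual
  | bang A => quest A.dual
  | quest A => bang A.dual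

/-- the propositional variable `x` occurs in the formula -/
def hasVar (x : ℕ) : CForm → Prop
  | pos n => n = x
  | neg n => n = x
  | one => False
  | bot => False
  | top => False
  | zero => False
  | tensor A B => hasVar x A ∨ hasVar x B
  | par A B => hasVar x A ∨ hasVar x B
  | and A B => hasVar x A ∨ hasVar x B
  | or A B => hasVar x A ∨ hasVar x B
  | bang A => hasVar x A
  | quest A => hasVar x A

/-- {⊗,⅋,&,⊕,1,⊥}-formulas (the language of InFLew) -/
def inMALL : CForm → Prop
  | pos _ => True
  | neg _ => True
  | one => True
  | bot => True
  | tensor A B => inMALL A ∧ inMALL B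
  | par A B => inMALL A ∧ inMALL B
  | and A B => inMALL A ∧ inMALL B
  | or A B => inMALL A ∧ inMALL B
  | _ => False

end CForm

/-- A parametrized one-sided classical sequent calculus. -/
structure CCalc where
  K : CForm → Prop
  ax : Set CForm
  wk : Prop      -- unrestricted weakening (W)
  der : Prop     -- dereliction (?)
  prom : Prop    -- promotion (!)
  funcF : Prop   -- the functorial rule (F) of ELLW
  qW : Prop      -- ?-weakening (?W), for LL

/-- Provability of a one-sided sequent `⊢ Γ` in the parametrized calculus `C`. -/
inductive CPrv (C : CCalc) : Multiset CForm → Prop where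
  | axiom' {B} : B ∈ C.ax → CPrv C {B}
  | init {A} : C.K A → C.K A.dual → CPrv C {A, A.dual}
  | one : C.K .one → CPrv C {.one}
  | top {Γ} : C.K .top → (∀ A ∈ Γ, C.K A) → CPrv C (.top ::ₘ Γ)
  | cut {Γ Δ A} : CPrv C (A ::ₘ Γ) → CPrv C (A.dual ::ₘ Δ) → CPrv C (Γ + Δ)
  | bot {Γ} : C.K .bot → CPrv C Γ → CPrv C (.bot ::ₘ Γ)
  | tensor {Γ Δ A B} : C.K (.tensor A B) → CPrv C (A ::ₘ Γ) → CPrv C (B ::ₘ Δ) →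
      CPrv C (.tensor A B ::ₘ (Γ + Δ))
  | par {Γ A B} : C.K (.par A B) → CPrv C (A ::ₘ B ::ₘ Γ) → CPrv C (.par A B ::ₘ Γ)
  | with' {Γ A B} : C.K (.and A B) → CPrv C (A ::ₘ Γ) → CPrv C (B ::ₘ Γ) →
      CPrv C (.and A B ::ₘ Γ)
  | plus1 {Γ A B} : C.K (.or A B) → CPrv C (A ::ₘ Γ) → CPrv C (.or A B ::ₘ Γ)
  | plus2 {Γ A B} : C.K (.or A B) → CPrv C (B ::ₘ Γ) → CPrv C (.or A B ::ₘ Γ)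
  | der {Γ A} : C.der → C.K (.quest A) → CPrv C (A ::ₘ Γ) → CPrv C (.quest A ::ₘ Γ)
  | prom {Γ : Multiset CForm} {A} : C.prom → C.K (.bang A) → (∀ B ∈ Γ, C.K (.quest B)) →
      CPrv C (A ::ₘ Γ.map .quest) → CPrv C (.bang A ::ₘ Γ.map .quest)
  | wk {Γ A} : C.wk → C.K A → CPrv C Γ → CPrv C (A ::ₘ Γ)
  | questW {Γ A} : C.qW → C.K (.quest A) → CPrv C Γ → CPrv C (.quest A ::ₘ Γ)
  | questC {Γ A} : C.K (.quest A) → CPrv C (.quest A ::ₘ .quest A ::ₘ Γ) →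
      CPrv C (.quest A ::ₘ Γ)
  | funcF {Γ : Multiset CForm} {A} : C.funcF → C.K (.bang A) → (∀ B ∈ Γ, C.K (.quest B)) →
      CPrv C (A ::ₘ Γ) → CPrv C (.bang A ::ₘ Γ.map .quest)

/-- LLW: classical affine logic, with a set of non-logical axioms. -/
def LLWc (Φ : Set CForm) : CCalc :=
  ⟨fun _ => True, Φ, True, True, True, False, False⟩

/-- ELLW: classical elementary affine logic. -/
def ELLWc (Φ : Set CForm) : CCalc :=
  ⟨fun _ => True, Φ, True, False, False, True, False⟩

/-- InFLew: the {⊗,⅋,&,⊕,1,⊥}-fragment of LLW. -/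
def InFLewc (Φ : Set CForm) : CCalc :=
  ⟨CForm.inMALL, Φ, True, False, False, False, False⟩

/-- LL: classical linear logic (weakening restricted to ?W). -/
def LLc (Φ : Set CForm) : CCalc :=
  ⟨fun _ => True, Φ, False, True, True, False, True⟩

/-- The translation (·)^[F] of classical formulas into intuitionistic formulas,
where ¬_F B := B ⊸ F. -/
def trF (F : IForm) : CForm → IForm
  | .pos n => .limp (.var n) F
  | .neg n => .var n
  | .one => .limp .one F
  | .bot => .one
  | .top => .zero
  | .zero => .limp .zero F
  | .tensor B C => .limp (.limp (trF F B) F) (trF F C)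
  | .par B C => .limp (.limp (trF F B) (.limp (trF F C) F)) F
  | .and B C => .or (trF F B) (trF F C)
  | .or B C => .limp (.or (.limp (trF F B) F) (.limp (trF F C) F)) F
  | .bang B => .limp (.bang (.limp (trF F B) F)) F
  | .quest B => .bang (trF F B)

/-- The embedding (·)̲ of ⊥-free intuitionistic formulas into classical formulas. -/
def emb : IForm → CForm
  | .var n => .pos n
  | .one => .one
  | .top => .top
  | .bot => .bot
  | .zero => .zero
  | .tensor A B => .tensor (emb A) (emb B)
  | .limp A B => .par (emb A).dual (emb B)
  | .and A B => .and (emb A) (emb B)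
  | .or A B => .or (emb A) (emb B)
  | .bang A => .bang (emb A)
  | .para A => .bang (emb A)

end Affine

namespace Affine

open scoped Pointwise

namespace CForm

theorem dual_dual (A : CForm) : A.dual.dual = A := by
  induction A <;> simp_all [dual]

theorem inMALL_dual {A : CForm} (h : A.inMALL) : A.dual.inMALL := by
  induction A <;> simp_all [dual, inMALL]

end CForm

section Deducibility

theorem CPrv.weaken {C : CCalc} (hw : C.wk) {Γ Δ : Multiset CForm} (hΔ : ∀ A ∈ Δ, C.K A)
    (h : CPrv C Γ) : CPrv C (Γ + Δ) := by
  induction Δ using Multiset.induction with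
  | empty => simpa using h
  | cons A Δ ih =>
    rw [Multiset.add_cons]
    exact .wk hw (hΔ A (by simp)) (ih fun B hB => hΔ B (by simp [hB]))

theorem CPrv.contract {C : CCalc} {Γ Δ : Multiset CForm} (hΓ : ∀ A ∈ Γ, C.K A.quest)
    (h : CPrv C (Γ.map .quest + (Γ.map .quest + Δ))) : CPrv C (Γ.map .quest + Δ) := by
  induction Γ using Multiset.induction generalizing Δ with
  | empty => simpa using h
  | cons A Γ ih =>
    have hA : C.K A.quest := hΓ A (by simp)
    have h' : CPrv C (Γ.map .quest + (Γ.map .quest + (A.quest ::ₘ A.quest ::ₘ Δ))) := by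
      convert h using 1
      simp only [Multiset.map_cons, Multiset.cons_add, Multiset.add_cons]
    have h'' := ih (fun B hB => hΓ B (by simp [hB])) h'
    rw [Multiset.map_cons, Multiset.cons_add]
    refine .questC hA ?_
    simpa only [Multiset.add_cons] using h''

/-- Discharging axioms `Γ⊥` into a `?Γ` context. -/
theorem CPrv.discharge {Γ Δ : Multiset CForm}
    (h : CPrv (InFLewc {B | B ∈ Γ.map CForm.dual}) Δ) :
    CPrv (LLWc ∅) (Γ.map .quest + Δ) := by
  induction h with
  | axiom' hB =>
    obtain ⟨A, hA, rfl⟩ := Multiset.mem_map.1 hB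
    obtain ⟨Γ, rfl⟩ := Multiset.exists_cons_of_mem hA
    have h : CPrv (LLWc ∅) (A.quest ::ₘ {A.dual}) := .der trivial trivial (.init trivial trivial)
    have h' := h.weaken (Δ := Γ.map .quest) trivial fun _ _ => trivial
    convert h' using 1
    rw [Multiset.map_cons, Multiset.cons_add, Multiset.cons_add, add_comm]
  | init =>
    rw [add_comm]
    exact (CPrv.init trivial trivial).weaken trivial fun _ _ => trivial
  | one =>
    rw [add_comm]
    exact (CPrv.one trivial).weaken trivial fun _ _ => trivial
  | top h => exact h.elim
  | cut _ _ ih₁ ih₂ =>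
    refine CPrv.contract (fun _ _ => trivial) ?_
    rw [Multiset.add_cons] at ih₁ ih₂
    convert CPrv.cut ih₁ ih₂ using 1
    abel
  | bot _ _ ih =>
    rw [Multiset.add_cons]
    exact .bot trivial ih
  | tensor _ _ _ ih₁ ih₂ =>
    refine CPrv.contract (fun _ _ => trivial) ?_
    rw [Multiset.add_cons] at ih₁ ih₂
    convert CPrv.tensor trivial ih₁ ih₂ using 1
    simp only [Multiset.add_cons]
    congr 1
    abel
  | par _ _ ih =>
    rw [Multiset.add_cons, Multiset.add_cons] at ih
    rw [Multiset.add_cons]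
    exact .par trivial ih
  | with' _ _ _ ih₁ ih₂ =>
    rw [Multiset.add_cons] at ih₁ ih₂ ⊢
    exact .with' trivial ih₁ ih₂
  | plus1 _ _ ih =>
    rw [Multiset.add_cons] at ih ⊢
    exact .plus1 trivial ih
  | plus2 _ _ ih =>
    rw [Multiset.add_cons] at ih ⊢
    exact .plus2 trivial ih
  | der h => exact h.elim
  | prom h => exact h.elim
  | wk _ _ _ ih =>
    rw [Multiset.add_cons]
    exact .wk trivial trivial ih
  | questW h => exact h.elim
  | questC h => exact h.elim
  | funcF h => exact h.elim

end Deducibility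

section PhaseSemantics

variable {M : Type*} [AddCommMonoid M]

/-- The orthogonal of `X` with respect to the pole `P`. -/
def orth (P X : Set M) : Set M := {x | ∀ y ∈ X, x + y ∈ P}

variable {P X Y : Set M}

theorem subset_orth_orth : X ⊆ orth P (orth P X) := fun x hx y hy => by
  rw [add_comm]
  exact hy x hx

theorem orth_anti (h : X ⊆ Y) : orth P Y ⊆ orth P X := fun _ hx y hy => hx y (h hy)

theorem orth_orth_orth : orth P (orth P (orth P X)) = orth P X :=
  (orth_anti subset_orth_orth).antisymm subset_orth_orth

theorem orth_univ (hP : ∀ x ∈ P, ∀ y, x + y ∈ P) : orth P Set.univ = P := by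
  ext x
  exact ⟨fun h => by simpa using h 0 trivial, fun h y _ => hP x h y⟩

theorem orth_self (hP : ∀ x ∈ P, ∀ y, x + y ∈ P) : orth P P = Set.univ :=
  Set.eq_univ_of_forall fun x y hy => by
    rw [add_comm]
    exact hP y hy x

theorem orth_setOf_or (hP : ∀ x ∈ P, ∀ y, x + y ∈ P) (p : Prop) :
    orth P {x | p ∨ x ∈ P} = {x | ¬p ∨ x ∈ P} := by
  by_cases hp : p
  · simpa [hp] using orth_univ hP
  · simpa [hp] using orth_self hP

/-- Phase semantics for affine logic, where `!` is the two-valued "is valid" operator. -/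
def sem (P : Set M) (v : ℕ → Set M) : CForm → Set M
  | .pos n => orth P (v n)
  | .neg n => orth P (orth P (v n))
  | .one => Set.univ
  | .bot => P
  | .top => Set.univ
  | .zero => P
  | .tensor A B => orth P (orth P (sem P v A + sem P v B))
  | .par A B => orth P (orth P (sem P v A) + orth P (sem P v B))
  | .and A B => sem P v A ∩ sem P v B
  | .or A B => orth P (orth P (sem P v A) ∩ orth P (sem P v B))
  | .bang A => {x | 0 ∈ sem P v A ∨ x ∈ P}
  | .quest A => {x | ¬ 0 ∈ orth P (sem P v A) ∨ x ∈ P}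

variable {v : ℕ → Set M}

theorem orth_orth_sem (hP : ∀ x ∈ P, ∀ y, x + y ∈ P) (A : CForm) :
    orth P (orth P (sem P v A)) = sem P v A := by
  induction A with
  | and A B ihA ihB =>
    refine Set.Subset.antisymm (Set.subset_inter ?_ ?_) subset_orth_orth
    · exact (orth_anti (orth_anti Set.inter_subset_left)).trans ihA.subset
    · exact (orth_anti (orth_anti Set.inter_subset_right)).trans ihB.subset
  | _ => simp [sem, orth_orth_orth, orth_univ hP, orth_self hP, orth_setOf_or hP]

theorem sem_dual (hP : ∀ x ∈ P, ∀ y, x + y ∈ P) (A : CForm) :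
    sem P v A.dual = orth P (sem P v A) := by
  induction A with
  | or A B ihA ihB =>
    have h := orth_orth_sem (v := v) hP (.and A.dual B.dual)
    simp only [sem, ihA, ihB] at h
    simp only [sem, CForm.dual, ihA, ihB, h]
  | _ => simp_all [sem, CForm.dual, orth_orth_orth, orth_univ hP, orth_self hP,
      orth_setOf_or hP, orth_orth_sem hP]

/-- The set of combinations of counter-elements to the formulas of a sequent. -/
def semCtx (P : Set M) (v : ℕ → Set M) (Γ : Multiset CForm) : Set M :=
  (Γ.map fun A => orth P (sem P v A)).sum

theorem semCtx_cons (A : CForm) (Γ : Multiset CForm) :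
    semCtx P v (A ::ₘ Γ) = orth P (sem P v A) + semCtx P v Γ := by
  simp [semCtx]

theorem semCtx_add (Γ Δ : Multiset CForm) :
    semCtx P v (Γ + Δ) = semCtx P v Γ + semCtx P v Δ := by
  simp [semCtx]

theorem semCtx_singleton (A : CForm) : semCtx P v {A} = orth P (sem P v A) := by
  simp [semCtx]

theorem semCtx_cons_subset (hP : ∀ x ∈ P, ∀ y, x + y ∈ P) {A : CForm} {Γ : Multiset CForm} :
    semCtx P v (A ::ₘ Γ) ⊆ P ↔ semCtx P v Γ ⊆ sem P v A := by
  rw [semCtx_cons, Set.add_subset_iff]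
  conv_rhs => rw [← orth_orth_sem hP]
  exact ⟨fun h y hy x hx => by simpa [add_comm] using h x hx y hy,
    fun h x hx y hy => by simpa [add_comm] using h hy x hx⟩

theorem orth_sem_quest (hP : ∀ x ∈ P, ∀ y, x + y ∈ P) (A : CForm) :
    orth P (sem P v A.quest) = {x | 0 ∈ orth P (sem P v A) ∨ x ∈ P} := by
  simp [sem, orth_setOf_or hP]

theorem zero_mem_or_subset_semCtx_quest (hP : ∀ x ∈ P, ∀ y, x + y ∈ P) (Γ : Multiset CForm) :
    0 ∈ semCtx P v (Γ.map .quest) ∨ semCtx P v (Γ.map .quest) ⊆ P := by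
  induction Γ using Multiset.induction with
  | empty => exact .inl (by simp [semCtx])
  | cons A Γ ih =>
    rw [Multiset.map_cons, semCtx_cons, orth_sem_quest hP]
    rcases ih with ih | ih
    · by_cases hA : 0 ∈ orth P (sem P v A)
      · exact .inl ⟨0, .inl hA, 0, ih, add_zero 0⟩
      · refine .inr (Set.add_subset_iff.2 fun x hx y _ => hP x (hx.resolve_left hA) y)
    · refine .inr (Set.add_subset_iff.2 fun x _ y hy => ?_)
      rw [add_comm]
      exact hP y (ih hy) x

theorem CPrv.sound (hP : ∀ x ∈ P, ∀ y, x + y ∈ P) {Γ : Multiset CForm}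
    (h : CPrv (LLWc ∅) Γ) : semCtx P v Γ ⊆ P := by
  induction h with
  | axiom' h => exact h.elim
  | @init A =>
    rw [Multiset.insert_eq_cons, semCtx_cons_subset hP, semCtx_singleton, sem_dual hP,
      orth_orth_sem hP]
  | one => exact (semCtx_cons_subset hP).2 (Set.subset_univ _)
  | top => exact (semCtx_cons_subset hP).2 (Set.subset_univ _)
  | cut _ _ ih₁ ih₂ =>
    rw [semCtx_cons_subset hP] at ih₁ ih₂
    rw [semCtx_add, Set.add_subset_iff]
    intro x hx y hy
    have hy' := ih₂ hy
    rw [sem_dual hP] at hy'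
    rw [add_comm]
    exact hy' x (ih₁ hx)
  | bot _ _ ih => exact (semCtx_cons_subset hP).2 ih
  | tensor _ _ _ ih₁ ih₂ =>
    rw [semCtx_cons_subset hP] at ih₁ ih₂ ⊢
    rw [semCtx_add]
    exact (Set.add_subset_add ih₁ ih₂).trans subset_orth_orth
  | par _ _ ih =>
    rw [semCtx_cons_subset hP]
    rw [semCtx_cons, semCtx_cons, ← add_assoc, Set.add_subset_iff] at ih
    intro x hx y hy
    rw [add_comm]
    exact ih y hy x hx
  | with' _ _ _ ih₁ ih₂ =>
    rw [semCtx_cons_subset hP] at ih₁ ih₂ ⊢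
    exact Set.subset_inter ih₁ ih₂
  | plus1 _ _ ih =>
    rw [semCtx_cons_subset hP] at ih ⊢
    exact (ih.trans subset_orth_orth).trans (orth_anti Set.inter_subset_left)
  | plus2 _ _ ih =>
    rw [semCtx_cons_subset hP] at ih ⊢
    exact (ih.trans subset_orth_orth).trans (orth_anti Set.inter_subset_right)
  | der _ _ _ ih =>
    rw [semCtx_cons_subset hP] at ih ⊢
    intro x hx
    refine or_iff_not_imp_left.2 fun h => ?_
    simpa using not_not.1 h x (ih hx)
  | @prom Γ A _ _ _ _ ih =>
    rw [semCtx_cons_subset hP] at ih ⊢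
    rcases zero_mem_or_subset_semCtx_quest (v := v) hP Γ with h | h
    · exact fun _ _ => .inl (ih h)
    · exact fun x hx => .inr (h hx)
  | @wk Γ A _ _ _ ih =>
    rw [semCtx_cons, Set.add_subset_iff]
    intro x _ y hy
    rw [add_comm]
    exact hP y (ih hy) x
  | questW h => exact h.elim
  | @questC Γ A _ _ ih =>
    rw [semCtx_cons, semCtx_cons, orth_sem_quest hP, Set.add_subset_iff] at ih
    rw [semCtx_cons, orth_sem_quest hP, Set.add_subset_iff]
    rintro x (hx | hx) y hy
    · exact ih x (.inl hx) y ⟨0, .inl hx, y, hy, zero_add y⟩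
    · exact hP x hx y
  | funcF h => exact h.elim

end PhaseSemantics

section CanonicalModel

variable {Φ : Set CForm} {A B : CForm} {x y : Multiset CForm}

open Classical in
/-- The sequents whose restriction to multiplicative-additive formulas is provable. -/
def pole (Φ : Set CForm) : Set (Multiset CForm) :=
  {x | CPrv (InFLewc Φ) (x.filter CForm.inMALL)}

open Classical in
theorem mem_pole : x ∈ pole Φ ↔ CPrv (InFLewc Φ) (x.filter CForm.inMALL) := by
  simp only [pole, Set.mem_ofPred_eq]

open Classical in
theorem mem_pole_cons (hA : A.inMALL) :
    A ::ₘ x ∈ pole Φ ↔ CPrv (InFLewc Φ) (A ::ₘ x.filter CForm.inMALL) := by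
  rw [mem_pole, Multiset.filter_cons_of_pos x hA]

theorem mem_pole_of_inMALL (hx : ∀ A ∈ x, A.inMALL) : x ∈ pole Φ ↔ CPrv (InFLewc Φ) x := by
  classical
  rw [mem_pole, Multiset.filter_eq_self.2 hx]

theorem pole_add (x : Multiset CForm) (hx : x ∈ pole Φ) (y : Multiset CForm) :
    x + y ∈ pole Φ := by
  classical
  rw [mem_pole] at hx ⊢
  rw [Multiset.filter_add]
  exact hx.weaken trivial fun A hA => (Multiset.mem_filter.1 hA).2

/-- The contexts that complete `A` to a sequent of the pole. -/
def slice (Φ : Set CForm) (A : CForm) : Set (Multiset CForm) := {x | A ::ₘ x ∈ pole Φ}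

theorem mem_slice : x ∈ slice Φ A ↔ A ::ₘ x ∈ pole Φ := Iff.rfl

theorem singleton_dual_mem_slice (hA : A.inMALL) : {A.dual} ∈ slice Φ A := by
  rw [mem_slice, mem_pole_of_inMALL (by simp [hA, CForm.inMALL_dual])]
  exact .init hA (CForm.inMALL_dual hA)

theorem add_mem_pole (hA : A.inMALL) (hx : x ∈ slice Φ A) (hy : y ∈ slice Φ A.dual) :
    x + y ∈ pole Φ := by
  classical
  rw [mem_slice, mem_pole_cons hA] at hx
  rw [mem_slice, mem_pole_cons (CForm.inMALL_dual hA)] at hy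
  rw [mem_pole, Multiset.filter_add]
  exact .cut hx hy

theorem orth_slice (hA : A.inMALL) : orth (pole Φ) (slice Φ A) = slice Φ A.dual := by
  ext x
  constructor
  · intro hx
    have h := hx _ (singleton_dual_mem_slice hA)
    rwa [add_comm, Multiset.singleton_add] at h
  · intro hx y hy
    rw [add_comm]
    exact add_mem_pole hA hy hx

theorem slice_one : slice Φ .one = Set.univ := by
  refine Set.eq_univ_of_forall fun x => ?_
  rw [mem_slice, ← Multiset.singleton_add]
  refine pole_add _ ?_ x
  rw [mem_pole_of_inMALL (by simp [CForm.inMALL])]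
  exact .one trivial

theorem slice_bot : slice Φ .bot = pole Φ := by
  have h := orth_slice (Φ := Φ) (A := .one) trivial
  rw [slice_one, orth_univ pole_add] at h
  exact h.symm

theorem slice_and (h : (CForm.and A B).inMALL) :
    slice Φ (.and A B) = slice Φ A ∩ slice Φ B := by
  classical
  obtain ⟨hA, hB⟩ := id h
  have hA' := CForm.inMALL_dual hA
  have hB' := CForm.inMALL_dual hB
  ext x
  constructor
  · intro hx
    constructor
    · rw [mem_slice, ← Multiset.singleton_add, add_comm]
      refine add_mem_pole (A := .and A B) ⟨hA, hB⟩ hx ?_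
      rw [mem_slice, mem_pole_of_inMALL (by simp [CForm.dual, CForm.inMALL, hA, hA', hB'])]
      refine .plus1 ⟨hA', hB'⟩ ?_
      rw [← Multiset.singleton_add, add_comm, Multiset.singleton_add]
      exact .init hA hA'
    · rw [mem_slice, ← Multiset.singleton_add, add_comm]
      refine add_mem_pole (A := .and A B) ⟨hA, hB⟩ hx ?_
      rw [mem_slice, mem_pole_of_inMALL (by simp [CForm.dual, CForm.inMALL, hB, hA', hB'])]
      refine .plus2 ⟨hA', hB'⟩ ?_
      rw [← Multiset.singleton_add, add_comm, Multiset.singleton_add]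
      exact .init hB hB'
  · rintro ⟨h₁, h₂⟩
    rw [mem_slice, mem_pole_cons hA] at h₁
    rw [mem_slice, mem_pole_cons hB] at h₂
    rw [mem_slice, mem_pole_cons h]
    exact .with' ⟨hA, hB⟩ h₁ h₂

theorem orth_slice_add_slice (h : (CForm.tensor A B).inMALL) :
    orth (pole Φ) (slice Φ A + slice Φ B) = slice Φ (CForm.tensor A B).dual := by
  classical
  obtain ⟨hA, hB⟩ := id h
  have hA' := CForm.inMALL_dual hA
  have hB' := CForm.inMALL_dual hB
  have h' : (CForm.par A.dual B.dual).inMALL := ⟨hA', hB'⟩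
  ext x
  constructor
  · intro hx
    have h := hx _ (Set.add_mem_add (singleton_dual_mem_slice hA) (singleton_dual_mem_slice hB))
    rw [add_comm, add_assoc, Multiset.singleton_add, Multiset.singleton_add,
      mem_pole_cons hA', Multiset.filter_cons_of_pos x hB'] at h
    rw [mem_slice, CForm.dual, mem_pole_cons h']
    exact .par ⟨hA', hB'⟩ h
  · rintro hx _ ⟨a, ha, b, hb, rfl⟩
    rw [add_comm]
    refine add_mem_pole (A := .tensor A B) ⟨hA, hB⟩ ?_ hx
    rw [mem_slice, mem_pole_cons hA] at ha
    rw [mem_slice, mem_pole_cons hB] at hb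
    rw [mem_slice, mem_pole_cons h, Multiset.filter_add]
    exact .tensor ⟨hA, hB⟩ ha hb

theorem orth_singleton_pos (n : ℕ) : orth (pole Φ) {{.pos n}} = slice Φ (.pos n) := by
  ext x
  simp [orth, mem_slice, ← Multiset.singleton_add, add_comm]

theorem sem_eq_slice (hA : A.inMALL) :
    sem (pole Φ) (fun n => {{.pos n}}) A = slice Φ A := by
  induction A with
  | pos n => simp [sem, orth_singleton_pos]
  | neg n => rw [sem, orth_singleton_pos, orth_slice (A := .pos n) trivial, CForm.dual]
  | one => rw [sem, slice_one]
  | bot => rw [sem, slice_bot]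
  | tensor A B ihA ihB =>
    rw [sem, ihA hA.1, ihB hA.2, orth_slice_add_slice hA, orth_slice (CForm.inMALL_dual hA),
      CForm.dual_dual]
  | par A B ihA ihB =>
    rw [sem, ihA hA.1, ihB hA.2, orth_slice hA.1, orth_slice hA.2,
      orth_slice_add_slice (CForm.inMALL_dual hA), CForm.dual, CForm.dual_dual, CForm.dual_dual]
  | and A B ihA ihB => rw [sem, ihA hA.1, ihB hA.2, slice_and hA]
  | or A B ihA ihB =>
    rw [sem, ihA hA.1, ihB hA.2, orth_slice hA.1, orth_slice hA.2,
      ← slice_and (CForm.inMALL_dual hA), ← CForm.dual, orth_slice (CForm.inMALL_dual hA),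
      CForm.dual_dual]
  | _ => exact hA.elim

theorem orth_sem_eq_slice_dual (hA : A.inMALL) :
    orth (pole Φ) (sem (pole Φ) (fun n => {{.pos n}}) A) = slice Φ A.dual := by
  rw [sem_eq_slice hA, orth_slice hA]

theorem mem_semCtx_of_inMALL (hx : ∀ A ∈ x, A.inMALL) :
    x ∈ semCtx (pole Φ) (fun n => {{.pos n}}) x := by
  induction x using Multiset.induction with
  | empty => simp [semCtx]
  | cons A x ih =>
    have hA : A.inMALL := hx A (by simp)
    rw [semCtx_cons, orth_sem_eq_slice_dual hA]
    refine ⟨{A}, ?_, x, ih fun B hB => hx B (by simp [hB]), Multiset.singleton_add A x⟩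
    simpa [CForm.dual_dual] using singleton_dual_mem_slice (Φ := Φ) (CForm.inMALL_dual hA)

theorem zero_mem_semCtx_quest (hx : ∀ A ∈ x, A.inMALL) (hΦ : ∀ A ∈ x, A.dual ∈ Φ) :
    0 ∈ semCtx (pole Φ) (fun n => {{.pos n}}) (x.map .quest) := by
  induction x using Multiset.induction with
  | empty => simp [semCtx]
  | cons A x ih =>
    have hA : A.inMALL := hx A (by simp)
    rw [Multiset.map_cons, semCtx_cons, orth_sem_quest pole_add, orth_sem_eq_slice_dual hA]
    refine ⟨0, .inl ?_, 0, ih (fun B hB => hx B (by simp [hB])) (fun B hB => hΦ B (by simp [hB])),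
      add_zero 0⟩
    rw [mem_slice, mem_pole_of_inMALL (by simp [CForm.inMALL_dual hA])]
    exact .axiom' (hΦ A (by simp))

end CanonicalModel

end Affine

namespace Affine
/-- The ?-prenex {⊗,⅋,&,⊕,1,⊥}-sequent `⊢ ?Γ,Δ` is provable in LLW iff
`⊢ Δ` is provable in InFLew[σ(Γ⊥)]. -/
theorem llw_prenex_iff_inflew_deducibility (Γ Δ : Multiset CForm)
    (hΓ : ∀ B ∈ Γ, B.inMALL) (hΔ : ∀ B ∈ Δ, B.inMALL) :
    CPrv (LLWc ∅) (Γ.map CForm.quest + Δ) ↔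
      CPrv (InFLewc {B | B ∈ Γ.map CForm.dual}) Δ := by
  refine ⟨fun h => ?_, CPrv.discharge⟩
  rw [← mem_pole_of_inMALL hΔ]
  refine h.sound pole_add ?_ (v := fun n => {{.pos n}})
  rw [semCtx_add]
  exact ⟨0, zero_mem_semCtx_quest hΓ fun A hA => Multiset.mem_map_of_mem _ hA, Δ,
    mem_semCtx_of_inMALL hΔ, zero_add Δ⟩
end Affine
end

section
/- Let Γ be a finite multiset of classical {⊗,⅋,&,⊕,1,⊥}-formulas and A a classical {⊗,⅋,&,⊕,1,⊥}-formula. Then ⊢ ?Γ,A is provable in LLW if and only if ⊢ ?Γ,!A is provable in ELLW. -/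
namespace Affine

theorem CForm.dual_dual_s12 (A : CForm) : A.dual.dual = A := by
  induction A <;> simp_all [CForm.dual]

/-- Derivability in ELLW up to finitely many extra copies of the context `Θ`. -/
def EllwModulo (Θ Δ : Multiset CForm) : Prop :=
  ∃ n : ℕ, CPrv (ELLWc ∅) (Δ + n • Θ)

theorem ellw_weaken {Δ : Multiset CForm} (h : CPrv (ELLWc ∅) Δ) (Ξ : Multiset CForm) :
    CPrv (ELLWc ∅) (Ξ + Δ) := by
  induction Ξ using Multiset.induction with
  | empty => simpa using h
  | cons A Ξ ih => rw [Multiset.cons_add]; exact .wk trivial trivial ih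

namespace EllwModulo

variable {Θ Δ Ξ : Multiset CForm} {A B : CForm}

theorem of_prv (h : CPrv (ELLWc ∅) Δ) : EllwModulo Θ Δ := ⟨0, by simpa using h⟩

theorem weaken (h : EllwModulo Θ Δ) (Ξ : Multiset CForm) : EllwModulo Θ (Ξ + Δ) := by
  obtain ⟨n, h⟩ := h
  exact ⟨n, by rw [add_assoc]; exact ellw_weaken h Ξ⟩

theorem cons (h : EllwModulo Θ Δ) (A : CForm) : EllwModulo Θ (A ::ₘ Δ) := by
  simpa using h.weaken {A}

theorem of_top_mem (h : CForm.top ∈ Δ) : EllwModulo Θ Δ := by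
  obtain ⟨Ξ, rfl⟩ := Multiset.exists_cons_of_mem h
  exact of_prv (.top trivial fun _ _ => trivial)

theorem map₁ (f : ∀ Λ, CPrv (ELLWc ∅) (Δ + Λ) → CPrv (ELLWc ∅) (Ξ + Λ))
    (h : EllwModulo Θ Δ) : EllwModulo Θ Ξ :=
  h.imp fun _ => f _

theorem cut (h₁ : EllwModulo Θ (A ::ₘ Δ)) (h₂ : EllwModulo Θ (A.dual ::ₘ Ξ)) :
    EllwModulo Θ (Δ + Ξ) := by
  obtain ⟨n, h₁⟩ := h₁
  obtain ⟨m, h₂⟩ := h₂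
  rw [Multiset.cons_add] at h₁ h₂
  refine ⟨n + m, ?_⟩
  rw [add_smul, add_add_add_comm]
  exact .cut h₁ h₂

theorem tensor (h₁ : EllwModulo Θ (A ::ₘ Δ)) (h₂ : EllwModulo Θ (B ::ₘ Ξ)) :
    EllwModulo Θ (.tensor A B ::ₘ (Δ + Ξ)) := by
  obtain ⟨n, h₁⟩ := h₁
  obtain ⟨m, h₂⟩ := h₂
  rw [Multiset.cons_add] at h₁ h₂
  refine ⟨n + m, ?_⟩
  rw [Multiset.cons_add, add_smul, add_add_add_comm]
  exact .tensor trivial h₁ h₂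

theorem and (h₁ : EllwModulo Θ (A ::ₘ Δ)) (h₂ : EllwModulo Θ (B ::ₘ Δ)) :
    EllwModulo Θ (.and A B ::ₘ Δ) := by
  obtain ⟨n, h₁⟩ := h₁
  obtain ⟨m, h₂⟩ := h₂
  refine ⟨n + m, ?_⟩
  rw [Multiset.cons_add]
  refine .with' trivial ?_ ?_
  · convert ellw_weaken h₁ (m • Θ) using 1
    rw [add_smul, Multiset.cons_add, Multiset.add_cons]
    congr 1
    abel
  · convert ellw_weaken h₂ (n • Θ) using 1
    rw [add_smul, Multiset.cons_add, Multiset.add_cons]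
    congr 1
    abel

theorem of_bot (h : EllwModulo Θ (.bot ::ₘ Δ)) : EllwModulo Θ Δ := by
  simpa using cut (Ξ := 0) h (of_prv (.one trivial))

end EllwModulo

open Classical in
/-- Evaluate every exponential subformula as a constant, according to derivability modulo `Θ`. -/
noncomputable def CForm.collapse (Θ : Multiset CForm) : CForm → CForm
  | .pos n => .pos n
  | .neg n => .neg n
  | .one => .one
  | .bot => .bot
  | .top => .top
  | .zero => .zero
  | .tensor A B => .tensor (A.collapse Θ) (B.collapse Θ)
  | .par A B => .par (A.collapse Θ) (B.collapse Θ)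
  | .and A B => .and (A.collapse Θ) (B.collapse Θ)
  | .or A B => .or (A.collapse Θ) (B.collapse Θ)
  | .bang A => if EllwModulo Θ {A.collapse Θ} then .one else .zero
  | .quest A => if EllwModulo Θ {(A.collapse Θ).dual} then .bot else .top

namespace CForm

theorem collapse_dual (Θ : Multiset CForm) (A : CForm) :
    A.dual.collapse Θ = (A.collapse Θ).dual := by
  induction A with
  | bang A ih => simp only [dual, collapse]; split_ifs <;> simp_all [dual, dual_dual_s12]
  | quest A ih => simp only [dual, collapse]; split_ifs <;> simp_all [dual]
  | _ => simp_all [dual, collapse]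

theorem collapse_of_inMALL (Θ : Multiset CForm) {A : CForm} (h : A.inMALL) :
    A.collapse Θ = A := by
  induction A <;> simp_all [inMALL, collapse]

theorem collapse_quest (Θ : Multiset CForm) (A : CForm) :
    EllwModulo Θ {(A.collapse Θ).dual} ∧ A.quest.collapse Θ = bot ∨
      A.quest.collapse Θ = top := by
  rw [collapse]; split_ifs <;> simp_all

end CForm

theorem EllwModulo.of_map_quest {Θ Δ Ξ : Multiset CForm}
    (h : EllwModulo Θ (Ξ + (Δ.map .quest).map (CForm.collapse Θ))) :
    CForm.top ∈ (Δ.map .quest).map (CForm.collapse Θ) ∨ EllwModulo Θ Ξ := by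
  induction Δ using Multiset.induction with
  | empty => right; simpa using h
  | cons B Δ ih =>
    simp only [Multiset.map_cons, Multiset.add_cons, Multiset.mem_cons] at h ⊢
    obtain ⟨-, hB⟩ | hB := CForm.collapse_quest Θ B
    · rw [hB] at h
      exact (ih h.of_bot).imp_left Or.inr
    · exact .inl (.inl hB.symm)

/-- The collapse is a sound interpretation of LLW. -/
theorem EllwModulo.of_llw (Θ : Multiset CForm) {Δ : Multiset CForm} (h : CPrv (LLWc ∅) Δ) :
    EllwModulo Θ (Δ.map (CForm.collapse Θ)) := by
  induction h with
  | axiom' h => exact h.elim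
  | @init A _ _ =>
    simp only [Multiset.insert_eq_cons, Multiset.map_cons, Multiset.map_singleton,
      CForm.collapse_dual]
    exact of_prv (.init trivial trivial)
  | one => exact of_prv (.one trivial)
  | top => exact of_top_mem (by simp [CForm.collapse])
  | cut _ _ h₁ h₂ =>
    rw [Multiset.map_cons] at h₁ h₂
    rw [CForm.collapse_dual] at h₂
    rw [Multiset.map_add]
    exact h₁.cut h₂
  | bot _ _ h => rw [Multiset.map_cons]; exact h.cons _
  | tensor _ _ _ h₁ h₂ =>
    rw [Multiset.map_cons] at h₁ h₂ ⊢
    rw [Multiset.map_add]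
    exact h₁.tensor h₂
  | par _ _ h =>
    simp only [Multiset.map_cons, CForm.collapse] at h ⊢
    refine h.map₁ fun Λ h => ?_
    rw [Multiset.cons_add] at h ⊢
    rw [Multiset.cons_add] at h
    exact .par trivial h
  | with' _ _ _ h₁ h₂ =>
    rw [Multiset.map_cons] at h₁ h₂ ⊢
    exact h₁.and h₂
  | plus1 _ _ h =>
    simp only [Multiset.map_cons, CForm.collapse] at h ⊢
    refine h.map₁ fun Λ h => ?_
    rw [Multiset.cons_add] at h ⊢
    exact .plus1 trivial h
  | plus2 _ _ h =>
    simp only [Multiset.map_cons, CForm.collapse] at h ⊢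
    refine h.map₁ fun Λ h => ?_
    rw [Multiset.cons_add] at h ⊢
    exact .plus2 trivial h
  | @der _ A _ _ _ h =>
    rw [Multiset.map_cons] at h ⊢
    obtain ⟨hA, hq⟩ | hq := CForm.collapse_quest Θ A
    · simpa using (h.cut (Ξ := 0) hA).cons _
    · exact of_top_mem (by simp [hq])
  | @prom Γ A _ _ _ _ h =>
    rw [Multiset.map_cons] at h ⊢
    by_cases hA : EllwModulo Θ {A.collapse Θ}
    · rw [CForm.collapse, if_pos hA, ← Multiset.singleton_add, add_comm]
      exact (of_prv (.one trivial)).weaken _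
    · rw [← Multiset.singleton_add] at h
      exact of_top_mem (Multiset.mem_cons_of_mem (h.of_map_quest.resolve_right hA))
  | wk _ _ _ h => rw [Multiset.map_cons]; exact h.cons _
  | questW h => exact h.elim
  | @questC _ A _ _ h =>
    simp only [Multiset.map_cons] at h ⊢
    obtain ⟨-, hq⟩ | hq := CForm.collapse_quest Θ A
    · rw [hq] at h ⊢
      exact h.of_bot
    · exact of_top_mem (by simp [hq])
  | funcF h => exact h.elim

theorem ellw_contract {Δ Ξ : Multiset CForm}
    (h : CPrv (ELLWc ∅) (Ξ + (Δ.map .quest + Δ.map .quest))) :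
    CPrv (ELLWc ∅) (Ξ + Δ.map .quest) := by
  induction Δ using Multiset.induction generalizing Ξ with
  | empty => simpa using h
  | cons B Δ ih =>
    rw [Multiset.map_cons, Multiset.add_cons]
    refine .questC trivial ?_
    rw [← Multiset.cons_add, ← Multiset.cons_add]
    refine ih ?_
    simpa [Multiset.cons_add, Multiset.add_cons] using h

theorem ellw_contract_smul {Δ Ξ : Multiset CForm} (n : ℕ)
    (h : CPrv (ELLWc ∅) (Ξ + n • Δ.map .quest)) : CPrv (ELLWc ∅) (Ξ + Δ.map .quest) := by
  induction n generalizing Ξ with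
  | zero =>
    rw [add_comm]
    exact ellw_weaken (by simpa using h) _
  | succ n ih =>
    refine ellw_contract ?_
    rw [← add_assoc]
    refine ih ?_
    rwa [succ_nsmul', ← add_assoc] at h

theorem llw_der_context {Δ Ξ : Multiset CForm} (h : CPrv (LLWc ∅) (Ξ + Δ)) :
    CPrv (LLWc ∅) (Ξ + Δ.map .quest) := by
  induction Δ using Multiset.induction generalizing Ξ with
  | empty => simpa using h
  | cons B Δ ih =>
    rw [Multiset.map_cons, Multiset.add_cons]
    refine .der trivial trivial ?_
    rw [← Multiset.cons_add]
    refine ih ?_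
    simpa [Multiset.cons_add, Multiset.add_cons] using h

theorem llw_of_ellw {Δ : Multiset CForm} (h : CPrv (ELLWc ∅) Δ) : CPrv (LLWc ∅) Δ := by
  induction h with
  | axiom' h => exact h.elim
  | init => exact .init trivial trivial
  | one => exact .one trivial
  | top => exact .top trivial fun _ _ => trivial
  | cut _ _ h₁ h₂ => exact .cut h₁ h₂
  | bot _ _ h => exact .bot trivial h
  | tensor _ _ _ h₁ h₂ => exact .tensor trivial h₁ h₂
  | par _ _ h => exact .par trivial h
  | with' _ _ _ h₁ h₂ => exact .with' trivial h₁ h₂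
  | plus1 _ _ h => exact .plus1 trivial h
  | plus2 _ _ h => exact .plus2 trivial h
  | der h => exact h.elim
  | prom h => exact h.elim
  | wk _ _ _ h => exact .wk trivial trivial h
  | questW h => exact h.elim
  | questC _ _ h => exact .questC trivial h
  | funcF _ _ _ _ h =>
    refine .prom trivial trivial (fun _ _ => trivial) ?_
    rw [← Multiset.singleton_add] at h ⊢
    exact llw_der_context h

/-- `⊢ ?Γ,A` is provable in LLW iff `⊢ ?Γ,!A` is provable in ELLW,
for {⊗,⅋,&,⊕,1,⊥}-formulas Γ, A. -/
theorem llw_iff_ellw_bang (Γ : Multiset CForm) (A : CForm)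
    (hΓ : ∀ B ∈ Γ, B.inMALL) (hA : A.inMALL) :
    CPrv (LLWc ∅) (A ::ₘ Γ.map CForm.quest) ↔
      CPrv (ELLWc ∅) (CForm.bang A ::ₘ Γ.map CForm.quest) := by
  constructor
  · intro h
    have h := EllwModulo.of_llw Γ h
    rw [Multiset.map_cons, CForm.collapse_of_inMALL Γ hA, ← Multiset.singleton_add] at h
    have hbot : CForm.top ∉ (Γ.map .quest).map (CForm.collapse Γ) := by
      simp only [Multiset.map_map, Multiset.mem_map, Function.comp_apply, not_exists, not_and]
      intro B hB
      have hB' : EllwModulo Γ {(B.collapse Γ).dual} := by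
        rw [CForm.collapse_of_inMALL Γ (hΓ B hB)]
        refine ⟨1, ?_⟩
        obtain ⟨Δ, hΔ⟩ := Multiset.exists_cons_of_mem hB
        have := ellw_weaken (.init (A := B) trivial trivial) Δ
        rw [hΔ, one_smul]
        convert this using 1
        rw [Multiset.insert_eq_cons, Multiset.add_cons, Multiset.add_cons, add_comm]
      rw [CForm.collapse, if_pos hB']
      exact CForm.noConfusion
    obtain ⟨n, h⟩ := h.of_map_quest.resolve_left hbot
    rw [Multiset.singleton_add] at h
    have h := CPrv.funcF (C := ELLWc ∅) trivial trivial (fun _ _ => trivial) h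
    rw [Multiset.map_nsmul, ← Multiset.singleton_add] at h
    simpa using ellw_contract_smul n h
  · intro h
    have hd : CPrv (LLWc ∅) (A.bang.dual ::ₘ {A}) := by
      refine .der trivial trivial ?_
      have := CPrv.init (C := LLWc ∅) (A := A) trivial trivial
      rwa [Multiset.pair_comm] at this
    have := (llw_of_ellw h).cut hd
    rwa [add_comm, Multiset.singleton_add] at this

end Affine
end

section
/- Let !Γ,Δ ⊢ C be a !-prenex {⊸}-sequent. Then Δ ⊢ C is provable in BCI[σ(Γ)] if and only if !Γ,Δ ⊢ C is provable in ILL. -/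
namespace Affine

open scoped Pointwise

theorem IForm.inImp.inLp {A : IForm} (h : A.inImp) : A.inLp := by
  induction A with
  | limp A B ihA ihB => exact ⟨ihA h.1, ihB h.2⟩
  | var n => trivial
  | _ => exact h.elim

/-! ### From deducibility to `!`-prenex sequents -/

/-- A multiset of banged formulas may be added on the left by `!W`. -/
theorem IPrv.bang_weakening {L : ICalc} (hW : L.bW) {Γ : Multiset IForm}
    (hΓ : ∀ B ∈ Γ, L.K (.bang B)) {Δ : Multiset IForm} {X : Option IForm} (h : IPrv L Δ X) :
    IPrv L (Γ.map .bang + Δ) X := by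
  induction Γ using Multiset.induction_on with
  | empty => simpa using h
  | cons B Γ ih =>
    rw [Multiset.map_cons, Multiset.cons_add]
    exact .bangW hW (hΓ B (by simp)) (ih fun C hC => hΓ C (by simp [hC]))

/-- Two copies of a multiset of banged formulas may be contracted. -/
theorem IPrv.bang_contraction {L : ICalc} {Γ : Multiset IForm}
    (hΓ : ∀ B ∈ Γ, L.K (.bang B)) {Δ : Multiset IForm} {X : Option IForm}
    (h : IPrv L (Γ.map .bang + (Γ.map .bang + Δ)) X) : IPrv L (Γ.map .bang + Δ) X := by
  induction Γ using Multiset.induction_on generalizing Δ with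
  | empty => simpa using h
  | cons B Γ ih =>
    rw [Multiset.map_cons, Multiset.cons_add]
    refine .bangC (hΓ B (by simp)) ?_
    rw [← Multiset.add_cons, ← Multiset.add_cons]
    refine ih (fun C hC => hΓ C (by simp [hC])) ?_
    simpa [Multiset.cons_add, Multiset.add_cons] using h

/-- Axioms of a `BCI` deduction can be internalised as banged hypotheses in `ILL`. -/
theorem IPrv.ill_of_bci {Γ : Multiset IForm} (hΓ : ∀ B ∈ Γ, B.inImp) {Δ : Multiset IForm}
    {X : Option IForm} (h : IPrv (BCIc {B | B ∈ Γ}) Δ X) :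
    IPrv (ILLc ∅) (Γ.map .bang + Δ) X := by
  have hb : ∀ B ∈ Γ, (ILLc ∅).K (.bang B) := fun B hB => (hΓ B hB).inLp
  induction h with
  | @axiom' B hB =>
    obtain ⟨Γ', rfl⟩ := Multiset.exists_cons_of_mem hB
    rw [Multiset.map_cons, Multiset.cons_add, add_zero]
    refine .bangD trivial (hb B hB) ?_
    have := IPrv.bang_weakening (L := ILLc ∅) (Γ := Γ') trivial (fun C hC => hb C (by simp [hC]))
      (.init (A := B) (hΓ B hB).inLp)
    rwa [add_comm, Multiset.singleton_add] at this
  | init hA => exact .bang_weakening trivial hb (.init hA.inLp)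
  | @cut Γ₁ Δ₁ X A _ _ ih₁ ih₂ =>
    rw [Multiset.add_cons] at ih₂
    refine .bang_contraction hb ?_
    have := ih₁.cut ih₂
    rwa [show Γ.map .bang + Γ₁ + (Γ.map .bang + Δ₁) = Γ.map .bang + (Γ.map .bang + (Γ₁ + Δ₁))
      by ac_rfl] at this
  | @limpL Γ₁ Δ₁ X A B hK _ _ ih₁ ih₂ =>
    rw [Multiset.add_cons] at ih₂
    refine .bang_contraction hb ?_
    have := IPrv.limpL hK.inLp ih₁ ih₂
    rwa [show Γ.map .bang + Γ₁ + (Γ.map .bang + Δ₁) = Γ.map .bang + (Γ.map .bang + (Γ₁ + Δ₁))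
      by ac_rfl, ← Multiset.add_cons, ← Multiset.add_cons] at this
  | limpR hK _ ih =>
    rw [Multiset.add_cons] at ih
    exact .limpR hK.inLp ih
  | _ => simp_all [BCIc, IForm.inImp]

/-! ### Phase semantics

The phase space is the monoid of contexts; its closure operator is induced by provability in a
calculus `L`. -/

/-- The closure of a set of contexts under consequences of provability in `L`. -/
def phaseCl (L : ICalc) (S : Set (Multiset IForm)) : Set (Multiset IForm) :=
  {m | ∀ D X, (∀ s ∈ S, IPrv L (s + D) X) → IPrv L (m + D) X}

theorem subset_phaseCl (L : ICalc) (S : Set (Multiset IForm)) : S ⊆ phaseCl L S :=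
  fun _ hm _ _ h => h _ hm

theorem phaseCl_add_subset {L : ICalc} {S U T : Set (Multiset IForm)} (hT : phaseCl L T ⊆ T)
    (h : S + U ⊆ T) : phaseCl L S + U ⊆ T := by
  rintro _ ⟨m, hm, u, hu, rfl⟩
  refine hT fun D X hX => ?_
  show IPrv L (m + u + D) X
  rw [add_assoc]
  refine hm _ _ fun s hs => ?_
  rw [← add_assoc]
  exact hX _ (h (Set.add_mem_add hs hu))

theorem phaseCl_subset {L : ICalc} {S T : Set (Multiset IForm)} (hT : phaseCl L T ⊆ T)
    (h : S ⊆ T) : phaseCl L S ⊆ T := by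
  simpa using phaseCl_add_subset (U := 0) hT (by simpa using h)

theorem phaseCl_mono {L : ICalc} {S T : Set (Multiset IForm)} (h : S ⊆ T) :
    phaseCl L S ⊆ phaseCl L T :=
  fun _ hm D X hX => hm D X fun s hs => hX s (h hs)

theorem phaseCl_idem (L : ICalc) (S : Set (Multiset IForm)) :
    phaseCl L (phaseCl L S) ⊆ phaseCl L S :=
  fun _ hm D X hX => hm D X fun _ hs => hs D X hX

/-- Interpretation of formulas; `!A` is the unit when `A` is true and the least fact otherwise.
The values at `⊥` and `§A`, which lie outside the language of `ILL`, are irrelevant. -/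
def phase (L : ICalc) : IForm → Set (Multiset IForm)
  | .var n => {m | IPrv L m (some (.var n))}
  | .one => phaseCl L 0
  | .zero => phaseCl L ∅
  | .tensor A B => phaseCl L (phase L A + phase L B)
  | .limp A B => {m | ∀ a ∈ phase L A, m + a ∈ phase L B}
  | .and A B => phase L A ∩ phase L B
  | .or A B => phaseCl L (phase L A ∪ phase L B)
  | .bang A => phaseCl L {m | m = 0 ∧ 0 ∈ phase L A}
  | .top => Set.univ
  | .bot => Set.univ
  | .para _ => Set.univ

/-- Interpretation of stoups. -/
def phaseStoup (L : ICalc) : Option IForm → Set (Multiset IForm)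
  | some A => phase L A
  | none => phaseCl L ∅

/-- Interpretation of contexts. -/
def phaseCtx (L : ICalc) (Γ : Multiset IForm) : Set (Multiset IForm) :=
  (Γ.map (phase L)).sum

@[simp]
theorem phaseCtx_zero (L : ICalc) : phaseCtx L 0 = 0 := by simp [phaseCtx]

@[simp]
theorem phaseCtx_cons (L : ICalc) (A : IForm) (Γ : Multiset IForm) :
    phaseCtx L (A ::ₘ Γ) = phase L A + phaseCtx L Γ := by simp [phaseCtx]

@[simp]
theorem phaseCtx_singleton (L : ICalc) (A : IForm) : phaseCtx L {A} = phase L A := by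
  simp [phaseCtx]

@[simp]
theorem phaseCtx_add (L : ICalc) (Γ Δ : Multiset IForm) :
    phaseCtx L (Γ + Δ) = phaseCtx L Γ + phaseCtx L Δ := by simp [phaseCtx]

theorem phaseCl_phase_subset (L : ICalc) (A : IForm) : phaseCl L (phase L A) ⊆ phase L A := by
  induction A with
  | var n =>
    intro m hm
    have := hm 0 (some (.var n)) fun s hs => by rwa [add_zero]
    rwa [add_zero] at this
  | limp A B _ ihB =>
    intro m hm a ha
    refine phaseCl_add_subset (S := phase L (.limp A B)) (U := phase L A) ihB ?_
      (Set.add_mem_add hm ha)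
    rintro _ ⟨s, hs, b, hb, rfl⟩
    exact hs b hb
  | and A B ihA ihB =>
    exact fun m hm => ⟨ihA (phaseCl_mono Set.inter_subset_left hm),
      ihB (phaseCl_mono Set.inter_subset_right hm)⟩
  | top | bot | para => exact Set.subset_univ _
  | one | zero | tensor | or | bang => exact phaseCl_idem L _

theorem phaseCl_phaseStoup_subset (L : ICalc) (X : Option IForm) :
    phaseCl L (phaseStoup L X) ⊆ phaseStoup L X := by
  cases X with
  | none => exact phaseCl_idem L _
  | some A => exact phaseCl_phase_subset L A

theorem phase_bang_add_subset {L : ICalc} {A : IForm} {U T : Set (Multiset IForm)}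
    (hT : phaseCl L T ⊆ T) (h : 0 ∈ phase L A → U ⊆ T) : phase L (.bang A) + U ⊆ T := by
  refine phaseCl_add_subset hT ?_
  rintro _ ⟨_, ⟨rfl, h0⟩, u, hu, rfl⟩
  simpa using h h0 hu

theorem zero_mem_phase_bang {L : ICalc} {A : IForm} (h : 0 ∈ phase L A) :
    0 ∈ phase L (.bang A) :=
  subset_phaseCl L _ ⟨rfl, h⟩

theorem phaseCtx_map_bang_add_subset {L : ICalc} {Γ : Multiset IForm}
    {U T : Set (Multiset IForm)} (hT : phaseCl L T ⊆ T)
    (h : (∀ B ∈ Γ, 0 ∈ phase L B) → U ⊆ T) : phaseCtx L (Γ.map .bang) + U ⊆ T := by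
  induction Γ using Multiset.induction_on with
  | empty => simpa using h
  | cons B Γ ih =>
    rw [Multiset.map_cons, phaseCtx_cons, add_assoc]
    refine phase_bang_add_subset hT fun hB => ih fun hΓ => h ?_
    simpa [hB] using hΓ

theorem zero_mem_phaseCtx_map_bang {L : ICalc} {Γ : Multiset IForm}
    (h : ∀ B ∈ Γ, 0 ∈ phase L B) : 0 ∈ phaseCtx L (Γ.map .bang) := by
  induction Γ using Multiset.induction_on with
  | empty => simp
  | cons B Γ ih =>
    rw [Multiset.map_cons, phaseCtx_cons]
    simpa using Set.add_mem_add (zero_mem_phase_bang (h B (by simp)))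
      (ih fun C hC => h C (by simp [hC]))

/-- Soundness of `ILL` for the phase semantics induced by any calculus. -/
theorem IPrv.phase_sound (L : ICalc) {Γ : Multiset IForm} {X : Option IForm}
    (h : IPrv (ILLc ∅) Γ X) : phaseCtx L Γ ⊆ phaseStoup L X := by
  induction h with
  | axiom' h => exact h.elim
  | init => simp [phaseStoup]
  | oneR => simpa [phaseStoup, phase] using subset_phaseCl L 0 rfl
  | botL h => exact h.elim
  | topR => exact Set.subset_univ _
  | zeroL =>
    rw [phaseCtx_cons]
    exact phaseCl_add_subset (phaseCl_phaseStoup_subset L _) (by simp)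
  | cut _ _ ih₁ ih₂ =>
    rw [phaseCtx_cons] at ih₂
    rw [phaseCtx_add]
    exact (Set.add_subset_add_right ih₁).trans ih₂
  | oneL _ _ ih =>
    rw [phaseCtx_cons]
    exact phaseCl_add_subset (phaseCl_phaseStoup_subset L _) (by simpa using ih)
  | botR h => exact h.elim
  | limpL _ _ _ ih₁ ih₂ =>
    rw [phaseCtx_cons] at ih₂
    rw [phaseCtx_cons, phaseCtx_add, ← add_assoc]
    refine (Set.add_subset_add_right ?_).trans ih₂
    rintro _ ⟨f, hf, a, ha, rfl⟩
    exact hf a (ih₁ ha)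
  | limpR _ _ ih =>
    intro m hm a ha
    rw [phaseCtx_cons] at ih
    rw [add_comm]
    exact ih (Set.add_mem_add ha hm)
  | tensorL _ _ ih =>
    rw [phaseCtx_cons]
    rw [phaseCtx_cons, phaseCtx_cons, ← add_assoc] at ih
    exact phaseCl_add_subset (phaseCl_phaseStoup_subset L _) ih
  | tensorR _ _ _ ih₁ ih₂ =>
    rw [phaseCtx_add]
    exact (Set.add_subset_add ih₁ ih₂).trans (subset_phaseCl L _)
  | withL1 _ _ ih =>
    rw [phaseCtx_cons] at *
    exact (Set.add_subset_add_right Set.inter_subset_left).trans ih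
  | withL2 _ _ ih =>
    rw [phaseCtx_cons] at *
    exact (Set.add_subset_add_right Set.inter_subset_right).trans ih
  | withR _ _ _ ih₁ ih₂ => exact Set.subset_inter ih₁ ih₂
  | plusL _ _ _ ih₁ ih₂ =>
    rw [phaseCtx_cons] at *
    refine phaseCl_add_subset (phaseCl_phaseStoup_subset L _) ?_
    rw [Set.union_add]
    exact Set.union_subset ih₁ ih₂
  | plusR1 _ _ ih => exact ih.trans (Set.subset_union_left.trans (subset_phaseCl L _))
  | plusR2 _ _ ih => exact ih.trans (Set.subset_union_right.trans (subset_phaseCl L _))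
  | bangD _ _ _ ih =>
    rw [phaseCtx_cons] at *
    refine phase_bang_add_subset (phaseCl_phaseStoup_subset L _) fun h0 u hu => ih ?_
    simpa using Set.add_mem_add h0 hu
  | bangP _ _ _ _ ih =>
    rw [← add_zero (phaseCtx L _)]
    refine phaseCtx_map_bang_add_subset (phaseCl_phaseStoup_subset L _) fun hΓ => ?_
    simpa [phaseStoup] using zero_mem_phase_bang (ih (zero_mem_phaseCtx_map_bang hΓ))
  | bangF h => exact h.elim
  | weakL h => exact h.elim
  | bangW _ _ _ ih =>
    rw [phaseCtx_cons]
    exact phase_bang_add_subset (phaseCl_phaseStoup_subset L _) fun _ => ih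
  | bangC _ _ ih =>
    rw [phaseCtx_cons] at *
    refine phase_bang_add_subset (phaseCl_phaseStoup_subset L _) fun h0 u hu => ih ?_
    rw [phaseCtx_cons]
    simpa using Set.add_mem_add (zero_mem_phase_bang h0)
      (Set.add_mem_add (zero_mem_phase_bang h0) hu)
  | weakR h => exact h.elim
  | lalBang h => exact h.elim
  | lalPara h => exact h.elim

/-- Over `BCI[Φ]`, an implicational formula is interpreted by the contexts that prove it. -/
theorem mem_phase_bci_iff {Φ : Set IForm} {A : IForm} (hA : A.inImp) {m : Multiset IForm} :
    m ∈ phase (BCIc Φ) A ↔ IPrv (BCIc Φ) m (some A) := by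
  induction A generalizing m with
  | var n => rfl
  | limp A B ihA ihB =>
    constructor
    · intro h
      have := (ihB hA.2).1 (h {A} ((ihA hA.1).2 (.init hA.1)))
      rw [add_comm, Multiset.singleton_add] at this
      exact .limpR hA this
    · intro h a ha
      have hB : IPrv (BCIc Φ) (.limp A B ::ₘ (a + 0)) (some B) :=
        .limpL hA ((ihA hA.1).1 ha) (.init hA.2)
      rw [add_zero] at hB
      exact (ihB hA.2).2 (h.cut hB)
  | _ => exact hA.elim

theorem mem_phaseCtx_bci {Φ : Set IForm} {Δ : Multiset IForm} (hΔ : ∀ B ∈ Δ, B.inImp) :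
    Δ ∈ phaseCtx (BCIc Φ) Δ := by
  induction Δ using Multiset.induction_on with
  | empty => simp
  | cons B Δ ih =>
    rw [phaseCtx_cons, ← Multiset.singleton_add]
    exact Set.add_mem_add ((mem_phase_bci_iff (hΔ B (by simp))).2 (.init (hΔ B (by simp))))
      (ih fun C hC => hΔ C (by simp [hC]))

/-- For a !-prenex {⊸}-sequent `!Γ,Δ ⊢ C`: `Δ ⊢ C` is provable in BCI[σ(Γ)]
iff `!Γ,Δ ⊢ C` is provable in ILL. -/
theorem bci_deducibility_iff_ill (Γ Δ : Multiset IForm) (Cf : IForm)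
    (hΓ : ∀ B ∈ Γ, B.inImp) (hΔ : ∀ B ∈ Δ, B.inImp) (hC : Cf.inImp) :
    IPrv (BCIc {B | B ∈ Γ}) Δ (some Cf) ↔
      IPrv (ILLc ∅) (Γ.map IForm.bang + Δ) (some Cf) := by
  refine ⟨IPrv.ill_of_bci hΓ, fun h => (mem_phase_bci_iff hC).1 ?_⟩
  have hs := h.phase_sound (BCIc {B | B ∈ Γ})
  rw [phaseCtx_add] at hs
  have h0 : (0 : Multiset IForm) ∈ phaseCtx (BCIc {B | B ∈ Γ}) (Γ.map .bang) :=
    zero_mem_phaseCtx_map_bang fun B hB => (mem_phase_bci_iff (hΓ B hB)).2 (.axiom' hB)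
  simpa [phaseStoup] using hs (Set.add_mem_add h0 (mem_phaseCtx_bci hΔ))
end Affine
end

section
/- Let !Γ,Δ ⊢ A be a !-prenex {⊸}-sequent. Then !Γ,Δ ⊢ A is provable in the {⊸,!}-fragment of ILLW if and only if !Γ,§Δ ⊢ §A is provable in ILAL, where §Δ prefixes each member of Δ with one §. -/
namespace Affine

namespace IForm

/-- Remove every occurrence of the modality `§`. -/
def erasePara : IForm → IForm
  | tensor A B => tensor A.erasePara B.erasePara
  | limp A B => limp A.erasePara B.erasePara
  | and A B => and A.erasePara B.erasePara
  | or A B => or A.erasePara B.erasePara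
  | bang A => bang A.erasePara
  | para A => A.erasePara
  | A => A

theorem erasePara_of_inImp {A : IForm} (h : A.inImp) : A.erasePara = A := by
  induction A with
  | limp A B ihA ihB => simp [erasePara, ihA h.1, ihB h.2]
  | var n => rfl
  | _ => exact h.elim

theorem inImpBang_erasePara {A : IForm} (h : A.inLAL) : A.erasePara.inImpBang := by
  induction A with
  | limp A B ihA ihB => exact ⟨ihA h.1, ihB h.2⟩
  | bang A ih => exact ih h
  | para A ih => exact ih h
  | var n => trivial
  | _ => exact h.elim

theorem inLAL_of_inImp {A : IForm} (h : A.inImp) : A.inLAL := by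
  induction A with
  | limp A B ihA ihB => exact ⟨ihA h.1, ihB h.2⟩
  | var n => trivial
  | _ => exact h.elim

/-- Resource semantics of {⊸,!}-formulas in a commutative monoid. Other connectives are
interpreted as falsity. -/
def Forces {M : Type*} [AddCommMonoid M] (v : ℕ → M → Prop) : IForm → M → Prop
  | var n, x => v n x
  | limp A B, x => ∀ y, Forces v A y → Forces v B (x + y)
  | bang A, _ => Forces v A 0
  | _, _ => False

theorem Forces.add_right {M : Type*} [AddCommMonoid M] {v : ℕ → M → Prop}
    (hv : ∀ n x y, v n x → v n (x + y)) {A : IForm} {x : M} (h : A.Forces v x) (y : M) :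
    A.Forces v (x + y) := by
  induction A generalizing x with
  | var n => exact hv n x y h
  | limp A B _ ihB =>
    intro z hz
    rw [add_right_comm]
    exact ihB (h z hz)
  | bang A _ => exact h
  | _ => exact h.elim

end IForm

namespace IPrv

open IForm

theorem inImpBang_sound {M : Type*} [AddCommMonoid M] {v : ℕ → M → Prop}
    (hv : ∀ n x y, v n x → v n (x + y)) {Γ : Multiset IForm} {X : Option IForm}
    (h : IPrv (ImpBangILLWc ∅) Γ X) :
    ∀ s, Multiset.Rel (Forces v) Γ s → ∀ A, X = some A → A.Forces v s.sum := by
  induction h with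
  | axiom' h => exact h.elim
  | init _ =>
    rintro s hs _ ⟨⟩
    rw [← Multiset.cons_zero, Multiset.rel_cons_left] at hs
    obtain ⟨b, t, hb, ht, rfl⟩ := hs
    rw [Multiset.rel_zero_left] at ht
    simpa [ht] using hb
  | oneR h => exact h.elim
  | botL h => exact h.elim
  | topR h _ => exact h.elim
  | zeroL h _ _ => exact h.elim
  | cut _ _ ih₁ ih₂ =>
    intro s hs C hC
    obtain ⟨s₁, s₂, h₁, h₂, rfl⟩ := Multiset.rel_add_left.1 hs
    simpa using ih₂ (s₁.sum ::ₘ s₂) (.cons (ih₁ s₁ h₁ _ rfl) h₂) C hC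
  | oneL h _ _ => exact h.elim
  | botR h _ _ => exact h.elim
  | limpL _ _ _ ih₁ ih₂ =>
    intro s hs C hC
    obtain ⟨b, t, hb, ht, rfl⟩ := Multiset.rel_cons_left.1 hs
    obtain ⟨s₁, s₂, h₁, h₂, rfl⟩ := Multiset.rel_add_left.1 ht
    simpa [add_assoc] using
      ih₂ ((b + s₁.sum) ::ₘ s₂) (.cons (hb _ (ih₁ s₁ h₁ _ rfl)) h₂) C hC
  | limpR _ _ ih =>
    rintro s hs _ ⟨⟩ y hy
    simpa [add_comm] using ih (y ::ₘ s) (.cons hy hs) _ rfl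
  | tensorL h _ _ => exact h.elim
  | tensorR h _ _ _ _ => exact h.elim
  | withL1 h _ _ => exact h.elim
  | withL2 h _ _ => exact h.elim
  | withR h _ _ _ _ => exact h.elim
  | plusL h _ _ _ _ => exact h.elim
  | plusR1 h _ _ => exact h.elim
  | plusR2 h _ _ => exact h.elim
  | bangD _ _ _ ih =>
    intro s hs C hC
    obtain ⟨b, t, hb, ht, rfl⟩ := Multiset.rel_cons_left.1 hs
    have hb' := Forces.add_right hv (show Forces v _ 0 from hb) b
    rw [zero_add] at hb'
    exact ih _ (.cons hb' ht) C hC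
  | @bangP Γ A _ _ _ _ ih =>
    rintro s hs _ ⟨⟩
    have hΓ : ∀ B ∈ Γ, Forces v (.bang B) (0 : M) := by
      intro B hB
      obtain ⟨_, _, hb⟩ := Multiset.exists_mem_of_rel_of_mem hs (Multiset.mem_map_of_mem _ hB)
      exact hb
    have := ih (Γ.map fun _ => 0)
      (Multiset.rel_map.2 (Multiset.rel_refl_of_refl_on hΓ)) _ rfl
    simpa [Forces] using this
  | weakL _ _ _ ih =>
    intro s hs C hC
    obtain ⟨b, t, _, ht, rfl⟩ := Multiset.rel_cons_left.1 hs
    simpa [add_comm] using Forces.add_right hv (ih t ht C hC) b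
  | bangW h _ _ _ => exact h.elim
  | bangC _ _ ih =>
    intro s hs C hC
    obtain ⟨b, t, hb, ht, rfl⟩ := Multiset.rel_cons_left.1 hs
    simpa using ih (b ::ₘ 0 ::ₘ t) (.cons hb (.cons hb ht)) C hC
  | bangF h _ _ _ _ => exact h.elim
  | weakR h _ _ _ => exact h.elim
  | lalBang h _ _ _ _ _ => exact h.elim
  | lalPara h _ _ _ _ _ => exact h.elim

theorem derelict {C : ICalc} (hD : C.bD) {Γ Δ : Multiset IForm} {X : Option IForm}
    (hΓ : ∀ B ∈ Γ, C.K (.bang B)) (h : IPrv C (Γ + Δ) X) :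
    IPrv C (Γ.map .bang + Δ) X := by
  induction Γ using Multiset.induction_on generalizing Δ with
  | empty => simpa using h
  | cons B Γ ih =>
    rw [Multiset.map_cons, Multiset.cons_add]
    refine bangD hD (hΓ B (Multiset.mem_cons_self _ _)) ?_
    rw [← Multiset.add_cons]
    exact ih (fun B' hB' => hΓ B' (Multiset.mem_cons_of_mem hB')) (by simpa using h)

theorem weaken {C : ICalc} (hW : C.wL) {Γ Δ : Multiset IForm} {X : Option IForm}
    (hΔ : ∀ B ∈ Δ, C.K B) (h : IPrv C Γ X) : IPrv C (Δ + Γ) X := by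
  induction Δ using Multiset.induction_on with
  | empty => simpa using h
  | cons B Δ ih =>
    rw [Multiset.cons_add]
    exact weakL hW (hΔ B (Multiset.mem_cons_self _ _))
      (ih fun B' hB' => hΔ B' (Multiset.mem_cons_of_mem hB'))

theorem contract_of_subset {C : ICalc} {Γ Γ' Δ : Multiset IForm} {X : Option IForm}
    (hΓ : ∀ B ∈ Γ, C.K (.bang B)) (hs : Γ' ⊆ Γ)
    (h : IPrv C (Γ'.map .bang + (Γ.map .bang + Δ)) X) : IPrv C (Γ.map .bang + Δ) X := by
  induction Γ' using Multiset.induction_on with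
  | empty => simpa using h
  | cons B Γ' ih =>
    rw [Multiset.cons_subset] at hs
    obtain ⟨Γ₀, rfl⟩ := Multiset.exists_cons_of_mem hs.1
    refine ih hs.2 ?_
    simp only [Multiset.map_cons, Multiset.cons_add, Multiset.add_cons] at h ⊢
    exact bangC (hΓ B hs.1) h

theorem erasePara {Γ : Multiset IForm} {X : Option IForm} (h : IPrv (ILALc ∅) Γ X) :
    IPrv (ImpBangILLWc ∅) (Γ.map IForm.erasePara) (X.map IForm.erasePara) := by
  induction h with
  | axiom' h => exact h.elim
  | init h => exact init (inImpBang_erasePara h)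
  | oneR h => exact h.elim
  | botL h => exact h.elim
  | topR h _ => exact h.elim
  | zeroL h _ _ => exact h.elim
  | cut _ _ ih₁ ih₂ =>
    rw [Multiset.map_add]
    rw [Multiset.map_cons] at ih₂
    exact cut ih₁ ih₂
  | oneL h _ _ => exact h.elim
  | botR h _ _ => exact h.elim
  | limpL h _ _ ih₁ ih₂ =>
    rw [Multiset.map_cons, Multiset.map_add]
    rw [Multiset.map_cons] at ih₂
    exact limpL (inImpBang_erasePara h) ih₁ ih₂
  | limpR h _ ih =>
    rw [Multiset.map_cons] at ih
    exact limpR (inImpBang_erasePara h) ih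
  | tensorL h _ _ => exact h.elim
  | tensorR h _ _ _ _ => exact h.elim
  | withL1 h _ _ => exact h.elim
  | withL2 h _ _ => exact h.elim
  | withR h _ _ _ _ => exact h.elim
  | plusL h _ _ _ _ => exact h.elim
  | plusR1 h _ _ => exact h.elim
  | plusR2 h _ _ => exact h.elim
  | bangD h _ _ _ => exact h.elim
  | bangP h _ _ _ _ => exact h.elim
  | bangF h _ _ _ _ => exact h.elim
  | weakL _ h _ ih =>
    rw [Multiset.map_cons]
    exact weakL trivial (inImpBang_erasePara h) ih
  | bangW h _ _ _ => exact h.elim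
  | bangC h _ ih =>
    rw [Multiset.map_cons, Multiset.map_cons] at ih
    rw [Multiset.map_cons]
    exact bangC (inImpBang_erasePara h) ih
  | weakR h _ _ _ => exact h.elim
  | @lalBang A E _ h hE _ _ ih =>
    have hE' : ∀ B ∈ E.map IForm.erasePara, (ImpBangILLWc ∅).K (.bang B) := by
      intro B hB
      obtain ⟨D, hD, rfl⟩ := Multiset.mem_map.1 hB
      exact inImpBang_erasePara (A := .bang D) (hE D hD)
    have hd := derelict (C := ImpBangILLWc ∅) trivial (Δ := 0) hE' (by simpa using ih)
    rw [add_zero] at hd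
    have hp := bangP (C := ImpBangILLWc ∅) trivial
      (inImpBang_erasePara (A := .bang A) h :) hE' hd
    simpa [Multiset.map_map, Function.comp_def, IForm.erasePara] using hp
  | @lalPara Γ Δ A _ _ hΓ _ _ ih =>
    have hΓ' : ∀ B ∈ Γ.map IForm.erasePara, (ImpBangILLWc ∅).K (.bang B) := by
      intro B hB
      obtain ⟨D, hD, rfl⟩ := Multiset.mem_map.1 hB
      exact inImpBang_erasePara (A := .bang D) (hΓ D hD)
    rw [Multiset.map_add] at ih
    simpa [Multiset.map_map, Function.comp_def, IForm.erasePara] using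
      derelict (C := ImpBangILLWc ∅) trivial hΓ' ih

end IPrv

open IForm

/-- `A` is derivable in ILAL from the resources `Δ` and arbitrarily many copies of members
of `Γ`, provided `Δ` lies in the language of ILAL. -/
def DerivableOver (Γ : Multiset IForm) (A : IForm) (Δ : Multiset IForm) : Prop :=
  (∀ B ∈ Δ, B.inLAL) → ∃ Γ' ⊆ Γ, IPrv (ILALc ∅) (Γ' + Δ) (some A)

theorem DerivableOver.add_right {Γ Δ : Multiset IForm} {A : IForm}
    (h : DerivableOver Γ A Δ) (Δ' : Multiset IForm) : DerivableOver Γ A (Δ + Δ') := by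
  intro hK
  obtain ⟨Γ', hs, hp⟩ := h fun B hB => hK B (Multiset.mem_add.2 (.inl hB))
  refine ⟨Γ', hs, ?_⟩
  have := hp.weaken (C := ILALc ∅) trivial (Δ := Δ')
    fun B hB => hK B (Multiset.mem_add.2 (.inr hB))
  rwa [add_comm, add_assoc] at this

theorem derivableOver_singleton (Γ : Multiset IForm) (A : IForm) : DerivableOver Γ A {A} :=
  fun hK => ⟨0, Multiset.zero_subset _, by
    rw [zero_add]
    exact .init (hK A (Multiset.mem_singleton_self A))⟩

theorem forces_derivableOver_iff {Γ : Multiset IForm} {A : IForm} (hA : A.inImp)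
    (Δ : Multiset IForm) :
    A.Forces (fun n => DerivableOver Γ (.var n)) Δ ↔ DerivableOver Γ A Δ := by
  induction A generalizing Δ with
  | var n => rfl
  | limp A B ihA ihB =>
    have hKA : A.inLAL := inLAL_of_inImp hA.1
    have hKB : B.inLAL := inLAL_of_inImp hA.2
    constructor
    · intro h hK
      obtain ⟨Γ', hs, hp⟩ := (ihB hA.2 _).1
        (h {A} ((ihA hA.1 _).2 (derivableOver_singleton Γ A))) (by
          intro C hC
          rcases Multiset.mem_add.1 hC with hC | hC
          · exact hK C hC
          · exact Multiset.mem_singleton.1 hC ▸ hKA)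
      refine ⟨Γ', hs, .limpR ⟨hKA, hKB⟩ ?_⟩
      rwa [← add_assoc, add_comm, Multiset.singleton_add] at hp
    · intro h Δ' hΔ'
      refine (ihB hA.2 _).2 fun hK => ?_
      obtain ⟨Γ₁, hs₁, hp₁⟩ := h fun C hC => hK C (Multiset.mem_add.2 (.inl hC))
      obtain ⟨Γ₂, hs₂, hp₂⟩ := (ihA hA.1 _).1 hΔ' fun C hC => hK C (Multiset.mem_add.2 (.inr hC))
      refine ⟨Γ₁ + Γ₂, ?_, ?_⟩
      · intro C hC
        rcases Multiset.mem_add.1 hC with hC | hC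
        exacts [hs₁ hC, hs₂ hC]
      · have hB : IPrv (ILALc ∅) (B ::ₘ 0) (some B) := .init hKB
        have := hp₁.cut (.limpL ⟨hKA, hKB⟩ hp₂ hB)
        rwa [add_zero, add_add_add_comm] at this
  | _ => exact hA.elim

/-- For a !-prenex {⊸}-sequent `!Γ,Δ ⊢ A`: `!Γ,Δ ⊢ A` is provable in the
{⊸,!}-fragment of ILLW iff `!Γ,§Δ ⊢ §A` is provable in ILAL. -/
theorem illw_iff_ilal (Γ Δ : Multiset IForm) (A : IForm)
    (hΓ : ∀ B ∈ Γ, B.inImp) (hΔ : ∀ B ∈ Δ, B.inImp) (hA : A.inImp) :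
    IPrv (ImpBangILLWc ∅) (Γ.map IForm.bang + Δ) (some A) ↔
      IPrv (ILALc ∅) (Γ.map IForm.bang + Δ.map IForm.para)
        (some (IForm.para A)) := by
  constructor
  · intro h
    have hΓK : ∀ B ∈ Γ, B.inLAL := fun B hB => inLAL_of_inImp (hΓ B hB)
    have hΔK : ∀ B ∈ Δ, B.inLAL := fun B hB => inLAL_of_inImp (hΔ B hB)
    have hΓF : ∀ B ∈ Γ, Forces (fun n => DerivableOver Γ (.var n)) (.bang B) 0 := fun B hB =>
      (forces_derivableOver_iff (hΓ B hB) 0).2 fun _ =>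
        ⟨{B}, by simpa using hB, .init (hΓK B hB)⟩
    have hΔF : ∀ B ∈ Δ, Forces (fun n => DerivableOver Γ (.var n)) B {B} := fun B hB =>
      (forces_derivableOver_iff (hΔ B hB) _).2 (derivableOver_singleton Γ B)
    have hF := h.inImpBang_sound (v := fun n => DerivableOver Γ (.var n))
      (fun _ _ y hx => hx.add_right y)
      (Γ.map (fun _ => 0) + Δ.map fun B => {B})
      (.add (Multiset.rel_map.2 (Multiset.rel_refl_of_refl_on hΓF))
        (Multiset.rel_map_right.2 (Multiset.rel_refl_of_refl_on hΔF))) A rfl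
    obtain ⟨Γ', hs, hp⟩ := (forces_derivableOver_iff hA Δ).1 (by simpa using hF) hΔK
    have hpara := IPrv.lalPara (C := ILALc ∅) trivial (A := A) (inLAL_of_inImp hA :)
      (fun B hB => hΓK B (hs hB)) hΔK hp
    refine IPrv.contract_of_subset hΓK hs ?_
    rw [add_left_comm]
    refine hpara.weaken (C := ILALc ∅) trivial fun B hB => ?_
    obtain ⟨D, hD, rfl⟩ := Multiset.mem_map.1 hB
    exact hΓK D hD
  · intro h
    have := h.erasePara
    have hΓe : (Γ.map bang).map IForm.erasePara = Γ.map bang := by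
      rw [Multiset.map_map]
      exact Multiset.map_congr rfl fun B hB =>
        congrArg bang (erasePara_of_inImp (hΓ B hB))
    have hΔe : (Δ.map para).map IForm.erasePara = Δ := by
      rw [Multiset.map_map]
      exact (Multiset.map_congr rfl fun B hB => erasePara_of_inImp (hΔ B hB)).trans
        (Multiset.map_id Δ)
    rwa [Multiset.map_add, hΓe, hΔe, Option.map_some, IForm.erasePara,
      erasePara_of_inImp hA] at this

end Affine
end

section
/- Let 𝒜 = ⟨Q,d,T_u,T_s,T_f,T_z⟩ be an ABVASS₀, Q_ℓ ⊆ Q, and (q,v̄) ∈ Q×ℕ^d. If there exists a Q_ℓ×{0̄}-leaf-covering lossy deduction tree with root (q,v̄) in 𝒜, then there exists a Q_ℓ×{0̄}-leaf-covering regular lossy deduction tree with root (q,v̄) in 𝒜. -/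
namespace Affine

/-- An ABVASS₀ (alternating branching VASS with full zero tests)
of dimension `d`. -/
structure ABVASS (d : ℕ) where
  Q : Type
  fin : Finite Q
  Tu : Set (Q × (Fin d → ℤ) × Q)
  Ts : Set (Q × Q × Q)
  Tf : Set (Q × Q × Q)
  Tz : Set (Q × Q)

/-- the i-th unit vector in ℕ^d -/
def unitVec {d : ℕ} (i : Fin d) : Fin d → ℕ := fun j => if j = i then 1 else 0

/-- `LossyDed A Ql q v` holds iff there is a `Ql × {0̄}`-leaf-covering lossy
deduction tree in `A` with root configuration `(q, v)`. -/
inductive LossyDed {d : ℕ} (A : ABVASS d) (Ql : Set A.Q) :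
    A.Q → (Fin d → ℕ) → Prop where
  | leaf {q} : q ∈ Ql → LossyDed A Ql q 0
  | unary {q q' : A.Q} {u : Fin d → ℤ} {v v' : Fin d → ℕ} :
      (q, u, q') ∈ A.Tu → (∀ i, (v' i : ℤ) = (v i : ℤ) + u i) →
      LossyDed A Ql q' v' → LossyDed A Ql q v
  | fork {q q1 q2 : A.Q} {v : Fin d → ℕ} : (q, q1, q2) ∈ A.Tf →
      LossyDed A Ql q1 v → LossyDed A Ql q2 v → LossyDed A Ql q v
  | split {q q1 q2 : A.Q} {v1 v2 : Fin d → ℕ} : (q, q1, q2) ∈ A.Ts →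
      LossyDed A Ql q1 v1 → LossyDed A Ql q2 v2 → LossyDed A Ql q (v1 + v2)
  | zero {q q' : A.Q} : (q, q') ∈ A.Tz → LossyDed A Ql q' 0 → LossyDed A Ql q 0
  | loss {q : A.Q} {v : Fin d → ℕ} (i : Fin d) :
      LossyDed A Ql q v → LossyDed A Ql q (v + unitVec i)

/-- `RegDed A Ql b q v` holds iff there is a *regular* `Ql × {0̄}`-leaf-covering
lossy deduction tree in `A` with root `(q, v)`: a loss rule may only be applied
directly on top of a leaf, another loss rule, or a full zero-test rule.  The
boolean flag `b` records whether the rule applied at the root is a leaf, a loss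
rule or a full zero-test. -/
inductive RegDed {d : ℕ} (A : ABVASS d) (Ql : Set A.Q) :
    Bool → A.Q → (Fin d → ℕ) → Prop where
  | leaf {q} : q ∈ Ql → RegDed A Ql true q 0
  | unary {b} {q q' : A.Q} {u : Fin d → ℤ} {v v' : Fin d → ℕ} :
      (q, u, q') ∈ A.Tu → (∀ i, (v' i : ℤ) = (v i : ℤ) + u i) →
      RegDed A Ql b q' v' → RegDed A Ql false q v
  | fork {b1 b2 : Bool} {q q1 q2 : A.Q} {v : Fin d → ℕ} : (q, q1, q2) ∈ A.Tf →
      RegDed A Ql b1 q1 v → RegDed A Ql b2 q2 v → RegDed A Ql false q v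
  | split {b1 b2 : Bool} {q q1 q2 : A.Q} {v1 v2 : Fin d → ℕ} :
      (q, q1, q2) ∈ A.Ts →
      RegDed A Ql b1 q1 v1 → RegDed A Ql b2 q2 v2 → RegDed A Ql false q (v1 + v2)
  | zero {b : Bool} {q q' : A.Q} : (q, q') ∈ A.Tz →
      RegDed A Ql b q' 0 → RegDed A Ql true q 0
  | loss {q : A.Q} {v : Fin d → ℕ} (i : Fin d) :
      RegDed A Ql true q v → RegDed A Ql true q (v + unitVec i)

/-- Regular deducibility is preserved, with the same flag, when one more token is added at the
root: the token is carried along every rule until it can be lost. -/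
theorem RegDed.add_unitVec {d : ℕ} {A : ABVASS d} {Ql : Set A.Q} {b : Bool} {q : A.Q}
    {v : Fin d → ℕ} (i : Fin d) (h : RegDed A Ql b q v) : RegDed A Ql b q (v + unitVec i) := by
  induction h with
  | leaf hq => exact .loss i (.leaf hq)
  | unary ht hv _ ih =>
    refine .unary ht (fun j => ?_) ih
    simp only [Pi.add_apply, Nat.cast_add, hv j]
    ring
  | fork ht _ _ ih₁ ih₂ => exact .fork ht ih₁ ih₂
  | split ht _ h₂ ih₁ _ =>
    rw [add_right_comm]
    exact .split ht ih₁ h₂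
  | zero ht h _ => exact .loss i (.zero ht h)
  | loss j h _ => exact .loss i (.loss j h)

/-- If there is a `Ql × {0̄}`-leaf-covering lossy deduction tree with root
`(q,v)`, then there is a regular one. -/
theorem lossy_to_regular {d : ℕ} (A : ABVASS d) (Ql : Set A.Q)
    (q : A.Q) (v : Fin d → ℕ) (h : LossyDed A Ql q v) :
    ∃ b, RegDed A Ql b q v := by
  induction h with
  | leaf hq => exact ⟨_, .leaf hq⟩
  | unary ht hv _ ih => exact ih.imp' (fun _ => false) fun _ h => .unary ht hv h
  | fork ht _ _ ih₁ ih₂ =>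
    obtain ⟨_, h₁⟩ := ih₁
    obtain ⟨_, h₂⟩ := ih₂
    exact ⟨_, .fork ht h₁ h₂⟩
  | split ht _ _ ih₁ ih₂ =>
    obtain ⟨_, h₁⟩ := ih₁
    obtain ⟨_, h₂⟩ := ih₂
    exact ⟨_, .split ht h₁ h₂⟩
  | zero ht _ ih => exact ih.imp' (fun _ => true) fun _ h => .zero ht h
  | loss i _ ih => exact ih.imp fun _ h => h.add_unitVec i

end Affine
end
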